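/- arXiv:2302.02266 — 5 statements merged into one kernel-verified Lean document; each statement's English description precedes it below -/
import Mathlib

section
/- Let E be a real inner product space, let a, b, c ∈ E, and let L, R ≥ 0. If ‖a − b‖ ≤ L, ‖c − a‖ ≥ R, and ‖c − b‖ ≥ R, then for every point p on the segment from a to b (i.e., p = (1 − t) • a + t • b for some t ∈ [0, 1]), one has ‖c − p‖² ≥ R² − L²/4. -/
/-- If `‖a − b‖ ≤ L`, `‖c − a‖ ≥ R`, and `‖c − b‖ ≥ R` (with `L, R ≥ 0`), then every point
`p = (1 − t) • a + t • b` on the segment from `a` to `b` (`t ∈ [0, 1]`) satisfies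
`‖c − p‖² ≥ R² − L²/4`. -/
theorem sq_dist_to_segment_ge {E : Type*} [NormedAddCommGroup E] [InnerProductSpace ℝ E]
    (a b c : E) (L R : ℝ) (hL : 0 ≤ L) (hR : 0 ≤ R)
    (hab : ‖a - b‖ ≤ L) (hca : ‖c - a‖ ≥ R) (hcb : ‖c - b‖ ≥ R) :
    ∀ t ∈ Set.Icc (0 : ℝ) 1, ‖c - ((1 - t) • a + t • b)‖ ^ 2 ≥ R ^ 2 - L ^ 2 / 4 := by
  rintro t ⟨ht0, ht1⟩
  have e1 : c - ((1 - t) • a + t • b) = (1 - t) • (c - a) + t • (c - b) := by module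
  have e2 : a - b = (c - b) - (c - a) := by abel
  have key : ‖c - ((1 - t) • a + t • b)‖ ^ 2
      = (1 - t) * ‖c - a‖ ^ 2 + t * ‖c - b‖ ^ 2 - t * (1 - t) * ‖a - b‖ ^ 2 := by
    rw [e1, e2, norm_add_sq_real, norm_sub_sq_real (c - b) (c - a), norm_smul, norm_smul,
      real_inner_smul_left, real_inner_smul_right, mul_pow, mul_pow, Real.norm_eq_abs,
      Real.norm_eq_abs, sq_abs, sq_abs, real_inner_comm (c - a) (c - b)]
    ring
  have h1 : R ^ 2 ≤ ‖c - a‖ ^ 2 := pow_le_pow_left₀ hR hca 2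
  have h2 : R ^ 2 ≤ ‖c - b‖ ^ 2 := pow_le_pow_left₀ hR hcb 2
  have h3 : ‖a - b‖ ^ 2 ≤ L ^ 2 := pow_le_pow_left₀ (norm_nonneg _) hab 2
  have h4 : t * (1 - t) ≤ 1 / 4 := by nlinarith [sq_nonneg (2 * t - 1)]
  have h5 : t * (1 - t) * ‖a - b‖ ^ 2 ≤ 1 / 4 * L ^ 2 :=
    mul_le_mul h4 h3 (by positivity) (by norm_num)
  have h6 := mul_le_mul_of_nonneg_left h1 (sub_nonneg.2 ht1)
  have h7 := mul_le_mul_of_nonneg_left h2 ht0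
  rw [key]
  linarith
end

section
/- Let E be a real inner product space, let a, b, c ∈ E, and let ρ ≥ 0. If ‖a − b‖ ≤ 2ρ, ‖c − a‖ ≥ 2ρ, and ‖c − b‖ ≥ 2ρ, then the infimum distance from c to the segment from a to b is at least √3 · ρ; that is, for every p = (1 − t) • a + t • b with t ∈ [0, 1], one has ‖c − p‖ ≥ √3 · ρ. -/
/-- If adjacent sphere centers `a, b` satisfy `‖a − b‖ ≤ 2ρ` and a third center `c` satisfies
`‖c − a‖ ≥ 2ρ` and `‖c − b‖ ≥ 2ρ`, then every point `p = (1 − t) • a + t • b` of the segment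
from `a` to `b` (`t ∈ [0, 1]`) satisfies `‖c − p‖ ≥ √3 · ρ`. -/
theorem dist_to_segment_ge_sqrt3 {E : Type*} [NormedAddCommGroup E] [InnerProductSpace ℝ E]
    (a b c : E) (ρ : ℝ) (hρ : 0 ≤ ρ)
    (hab : ‖a - b‖ ≤ 2 * ρ) (hca : ‖c - a‖ ≥ 2 * ρ) (hcb : ‖c - b‖ ≥ 2 * ρ) :
    ∀ t ∈ Set.Icc (0 : ℝ) 1, ‖c - ((1 - t) • a + t • b)‖ ≥ Real.sqrt 3 * ρ := by
  rintro t ⟨h0, h1⟩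
  have e1 : c - ((1 - t) • a + t • b) = (1 - t) • (c - a) + t • (c - b) := by module
  have e2 : a - b = (c - b) - (c - a) := by abel
  rw [e1]
  rw [e2] at hab
  generalize c - a = u at *
  generalize c - b = v at *
  have key : ‖(1 - t) • u + t • v‖ ^ 2
      = (1 - t) * ‖u‖ ^ 2 + t * ‖v‖ ^ 2 - t * (1 - t) * ‖v - u‖ ^ 2 := by
    rw [norm_add_sq_real, norm_sub_sq_real, norm_smul, norm_smul, inner_smul_left,
      inner_smul_right, real_inner_comm u v, mul_pow, mul_pow, Real.norm_eq_abs,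
      Real.norm_eq_abs, sq_abs, sq_abs]
    simp only [conj_trivial]
    ring
  have hu : (2 * ρ) ^ 2 ≤ ‖u‖ ^ 2 := by gcongr
  have hv : (2 * ρ) ^ 2 ≤ ‖v‖ ^ 2 := by gcongr
  have hd : ‖v - u‖ ^ 2 ≤ (2 * ρ) ^ 2 := by gcongr
  refine (pow_le_pow_iff_left₀ (by positivity) (norm_nonneg _) two_ne_zero).1 ?_
  rw [key, mul_pow, Real.sq_sqrt (by norm_num)]
  have a1 := mul_le_mul_of_nonneg_left hu (sub_nonneg.2 h1)
  have a2 := mul_le_mul_of_nonneg_left hv h0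
  have a3 := mul_le_mul_of_nonneg_left hd (mul_nonneg h0 (sub_nonneg.2 h1))
  have a4 : 0 ≤ (ρ * (2 * t - 1)) ^ 2 := sq_nonneg _
  linarith
end

section
/- Let E be a real inner product space, let r > 0, and let λ* = 1/(√3 − 1). Let a, b, c ∈ E satisfy ‖a − b‖ ≤ 2·λ*·r, ‖c − a‖ ≥ 2·λ*·r, and ‖c − b‖ ≥ 2·λ*·r. Then for every p = (1 − t) • a + t • b with t ∈ [0, 1], one has ‖c − p‖ ≥ (1 + λ*) · r. Consequently, the closed ball of radius r centered at c is disjoint from the open capsule { q ∈ E : infimum distance from q to the segment from a to b is strictly less than λ*·r }. -/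
/-- Geometric content of the paper's Theorem 1 (continuous-time feasibility).
With `λ* = 1/(√3 − 1)`, if `‖a − b‖ ≤ 2λ*r`, `‖c − a‖ ≥ 2λ*r`, `‖c − b‖ ≥ 2λ*r`, then every
point `p = (1 − t) • a + t • b` (`t ∈ [0, 1]`) of the segment satisfies `‖c − p‖ ≥ (1 + λ*)·r`;
consequently the closed ball of radius `r` at `c` is disjoint from the open capsule of radius
`λ*·r` around the segment from `a` to `b`. -/
theorem closedBall_disjoint_open_capsule {E : Type*} [NormedAddCommGroup E]
    [InnerProductSpace ℝ E] (r : ℝ) (hr : 0 < r) (lam : ℝ)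
    (hlam : lam = 1 / (Real.sqrt 3 - 1)) (a b c : E)
    (hab : ‖a - b‖ ≤ 2 * lam * r) (hca : ‖c - a‖ ≥ 2 * lam * r)
    (hcb : ‖c - b‖ ≥ 2 * lam * r) :
    (∀ t ∈ Set.Icc (0 : ℝ) 1, ‖c - ((1 - t) • a + t • b)‖ ≥ (1 + lam) * r) ∧
      Disjoint (Metric.closedBall c r)
        {q : E | Metric.infDist q (segment ℝ a b) < lam * r} := by
  have hs2 : Real.sqrt 3 ^ 2 = 3 := Real.sq_sqrt (by norm_num)
  have hs0 : 0 ≤ Real.sqrt 3 := Real.sqrt_nonneg 3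
  have hs1 : 1 < Real.sqrt 3 := by nlinarith
  have hl0 : 0 < lam := by rw [hlam]; exact div_pos one_pos (by linarith)
  have hl : Real.sqrt 3 * lam = 1 + lam := by
    have : Real.sqrt 3 - 1 ≠ 0 := by linarith
    rw [hlam]; field_simp; ring
  have hl2 : 3 * lam ^ 2 = (1 + lam) ^ 2 := by rw [← hl, mul_pow, hs2]
  have key : ∀ t ∈ Set.Icc (0 : ℝ) 1, ‖c - ((1 - t) • a + t • b)‖ ≥ (1 + lam) * r := by
    rintro t ⟨ht0, ht1⟩
    have stew : ‖c - ((1 - t) • a + t • b)‖ ^ 2 =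
        (1 - t) * ‖c - a‖ ^ 2 + t * ‖c - b‖ ^ 2 - t * (1 - t) * ‖a - b‖ ^ 2 := by
      have h1 : c - ((1 - t) • a + t • b) = (1 - t) • (c - a) + t • (c - b) := by module
      have h2 : a - b = (c - b) - (c - a) := by abel
      rw [h1, h2, norm_add_sq_real, norm_sub_sq_real (c - b) (c - a), norm_smul, norm_smul, inner_smul_left,
        inner_smul_right, real_inner_comm (c - a) (c - b), mul_pow, mul_pow,
        Real.norm_eq_abs, Real.norm_eq_abs, sq_abs, sq_abs]
      simp only [conj_trivial]
      ring
    have hL : 0 ≤ 2 * lam * r := by positivity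
    have ha : (2 * lam * r) ^ 2 ≤ ‖c - a‖ ^ 2 := pow_le_pow_left₀ hL hca 2
    have hb : (2 * lam * r) ^ 2 ≤ ‖c - b‖ ^ 2 := pow_le_pow_left₀ hL hcb 2
    have hd : ‖a - b‖ ^ 2 ≤ (2 * lam * r) ^ 2 := pow_le_pow_left₀ (norm_nonneg _) hab 2
    have e1 := mul_le_mul_of_nonneg_left ha (sub_nonneg.2 ht1)
    have e2 := mul_le_mul_of_nonneg_left hb ht0
    have e3 := mul_le_mul_of_nonneg_left hd (mul_nonneg ht0 (sub_nonneg.2 ht1))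
    have e4 : 0 ≤ (2 * lam * r) ^ 2 * (t - 1 / 2) ^ 2 := by positivity
    have e5 : ((1 + lam) * r) ^ 2 = 3 / 4 * (2 * lam * r) ^ 2 := by
      rw [mul_pow, ← hl2]; ring
    refine abs_le_of_sq_le_sq' ?_ (norm_nonneg _) |>.2
    rw [stew, e5]
    linarith
  refine ⟨key, Set.disjoint_left.2 ?_⟩
  intro q hq hq'
  rw [Set.mem_ofPred_eq, Metric.infDist_lt_iff ⟨a, left_mem_segment ℝ a b⟩] at hq'
  obtain ⟨y, hy, hqy⟩ := hq'
  rw [segment_eq_image] at hy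
  obtain ⟨t, ht, rfl⟩ := hy
  have h := key t ht
  rw [← dist_eq_norm] at h
  have h3 := dist_triangle_left c ((1 - t) • a + t • b) q
  rw [Metric.mem_closedBall] at hq
  linarith
end

section
/- In the Euclidean plane ℝ², let r > 0 and λ* = 1/(√3 − 1), and set a = (0, 0), b = (2·λ*·r, 0), and c = (λ*·r, √3·λ*·r). Then ‖a − b‖ = ‖c − a‖ = ‖c − b‖ = 2·λ*·r, and the infimum distance from c to the segment from a to b equals exactly (1 + λ*) · r; in particular, the closed ball of radius r centered at c and the closed capsule of radius λ*·r around the segment from a to b are tangent: their intersection is nonempty, while the open ball of radius r at c is disjoint from the open capsule of radius λ*·r. -/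
/-- Exact tangency in the paper's Theorem 1: in the Euclidean plane, with `λ* = 1/(√3 − 1)`,
`a = (0,0)`, `b = (2λ*r, 0)`, `c = (λ*r, √3·λ*r)`, all pairwise distances equal `2λ*r`, the
infimum distance from `c` to the segment from `a` to `b` equals exactly `(1 + λ*)·r`, and the
closed ball of radius `r` at `c` is tangent to the closed capsule of radius `λ*·r` around the
segment: their intersection is nonempty, while the open ball is disjoint from the open capsule. -/
theorem sphere_tangent_to_capsule (r : ℝ) (hr : 0 < r) (lam : ℝ)
    (hlam : lam = 1 / (Real.sqrt 3 - 1))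
    (a b c : EuclideanSpace ℝ (Fin 2))
    (ha : a = (WithLp.equiv 2 (Fin 2 → ℝ)).symm ![0, 0])
    (hb : b = (WithLp.equiv 2 (Fin 2 → ℝ)).symm ![2 * lam * r, 0])
    (hc : c = (WithLp.equiv 2 (Fin 2 → ℝ)).symm ![lam * r, Real.sqrt 3 * lam * r]) :
    ‖a - b‖ = 2 * lam * r ∧ ‖c - a‖ = 2 * lam * r ∧ ‖c - b‖ = 2 * lam * r ∧
      Metric.infDist c (segment ℝ a b) = (1 + lam) * r ∧
      (Metric.closedBall c r ∩
        {q : EuclideanSpace ℝ (Fin 2) |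
          Metric.infDist q (segment ℝ a b) ≤ lam * r}).Nonempty ∧
      Disjoint (Metric.ball c r)
        {q : EuclideanSpace ℝ (Fin 2) |
          Metric.infDist q (segment ℝ a b) < lam * r} := by
  have h3 : Real.sqrt 3 ^ 2 = 3 := Real.sq_sqrt (by norm_num)
  have h30 : 0 ≤ Real.sqrt 3 := Real.sqrt_nonneg 3
  have h31 : 1 < Real.sqrt 3 := by nlinarith
  have hl0 : 0 < lam := by rw [hlam]; exact one_div_pos.mpr (by linarith)
  have hl : Real.sqrt 3 * lam = 1 + lam := by
    have : lam * (Real.sqrt 3 - 1) = 1 := by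
      rw [hlam]; exact one_div_mul_cancel (by linarith)
    linarith
  have hlr : 0 < lam * r := mul_pos hl0 hr
  have ha0 : a 0 = 0 := by simp [ha]
  have ha1 : a 1 = 0 := by simp [ha]
  have hb0 : b 0 = 2 * lam * r := by simp [hb]
  have hb1 : b 1 = 0 := by simp [hb]
  have hc0 : c 0 = lam * r := by simp [hc]
  have hc1 : c 1 = Real.sqrt 3 * lam * r := by simp [hc]
  clear ha hb hc
  have key : ∀ (v : EuclideanSpace ℝ (Fin 2)) (d : ℝ), 0 ≤ d → v 0 ^ 2 + v 1 ^ 2 = d ^ 2 →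
      ‖v‖ = d := by
    intro v d hd h
    rw [EuclideanSpace.norm_eq, Fin.sum_univ_two, Real.norm_eq_abs, Real.norm_eq_abs, sq_abs,
      sq_abs, h, Real.sqrt_sq hd]
  have hab : ‖a - b‖ = 2 * lam * r := by
    apply key _ _ (by linarith)
    simp only [PiLp.sub_apply, ha0, ha1, hb0, hb1]; ring
  have hca : ‖c - a‖ = 2 * lam * r := by
    apply key _ _ (by linarith)
    simp only [PiLp.sub_apply, ha0, ha1, hc0, hc1]
    linear_combination (lam * r) ^ 2 * h3
  have hcb : ‖c - b‖ = 2 * lam * r := by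
    apply key _ _ (by linarith)
    simp only [PiLp.sub_apply, hb0, hb1, hc0, hc1]
    linear_combination (lam * r) ^ 2 * h3
  have hne : (segment ℝ a b).Nonempty := ⟨a, left_mem_segment ℝ a b⟩
  obtain ⟨m, hm⟩ : ∃ m, m = (1 / 2 : ℝ) • a + (1 / 2 : ℝ) • b := ⟨_, rfl⟩
  have hms : m ∈ segment ℝ a b :=
    ⟨1 / 2, 1 / 2, by norm_num, by norm_num, by norm_num, hm.symm⟩
  have hm0 : m 0 = lam * r := by
    rw [hm]; simp only [PiLp.add_apply, PiLp.smul_apply, smul_eq_mul, ha0, hb0]; ring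
  have hm1 : m 1 = 0 := by
    rw [hm]; simp only [PiLp.add_apply, PiLp.smul_apply, smul_eq_mul, ha1, hb1]; ring
  have hinf : Metric.infDist c (segment ℝ a b) = (1 + lam) * r := by
    apply le_antisymm
    · refine (Metric.infDist_le_dist_of_mem hms).trans (le_of_eq ?_)
      rw [dist_eq_norm]
      apply key _ _ (by nlinarith)
      simp only [PiLp.sub_apply, hm0, hm1, hc0, hc1, hl]; ring
    · rw [Metric.le_infDist hne]
      rintro y ⟨s, t, _, _, _, rfl⟩
      rw [dist_eq_norm]
      have h := PiLp.norm_apply_le (c - (s • a + t • b)) 1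
      simp only [PiLp.sub_apply, PiLp.add_apply, PiLp.smul_apply, smul_eq_mul, ha1, hb1, hc1,
        hl, mul_zero, add_zero, sub_zero] at h
      exact (le_abs_self _).trans h
  refine ⟨hab, hca, hcb, hinf, ?_, ?_⟩
  · refine ⟨!₂[lam * r, lam * r], ?_, ?_⟩
    · rw [Metric.mem_closedBall, dist_eq_norm]
      apply le_of_eq
      apply key _ _ hr.le
      simp [hc0, hc1, hl]; ring
    · refine (Metric.infDist_le_dist_of_mem hms).trans (le_of_eq ?_)
      rw [dist_eq_norm]
      apply key _ _ hlr.le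
      simp [hm0, hm1]
  · rw [Set.disjoint_left]
    intro q hq hq'
    rw [Metric.mem_ball, dist_comm] at hq
    rw [Set.mem_setOf_eq] at hq'
    have := Metric.infDist_le_infDist_add_dist (s := segment ℝ a b) (x := c) (y := q)
    linarith
end

section
/- Let a > 0, v₀ ≥ 0, and D > 0, and define δt = (−v₀ + √(v₀² + 2·a·D)) / a. Let f : ℝ → ℝ be twice differentiable with f(0) = 0, f′(0) = v₀, and |f″(t)| ≤ a for all t ∈ ℝ. If T ≥ 0 and f(T) = D, then T ≥ δt. -/
/-- Minimality of the paper's timestep formula (equation (4)): with `a > 0`, `v₀ ≥ 0`, `D > 0`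
and `δt = (−v₀ + √(v₀² + 2aD))/a`, any twice differentiable trajectory `f` with `f 0 = 0`,
`f′ 0 = v₀`, and `|f″| ≤ a` everywhere that reaches `f T = D` at some time `T ≥ 0` satisfies
`T ≥ δt`. -/
theorem min_timestep_bound (a v₀ D : ℝ) (ha : 0 < a) (hv0 : 0 ≤ v₀) (hD : 0 < D)
    (δt : ℝ) (hδt : δt = (-v₀ + Real.sqrt (v₀ ^ 2 + 2 * a * D)) / a)
    (f : ℝ → ℝ) (hf : Differentiable ℝ f) (hf' : Differentiable ℝ (deriv f))
    (h0 : f 0 = 0) (hfv0 : deriv f 0 = v₀)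
    (hacc : ∀ t : ℝ, |deriv (deriv f) t| ≤ a)
    (T : ℝ) (hT : 0 ≤ T) (hfT : f T = D) :
    T ≥ δt := by
  have h1 : ∀ t : ℝ, 0 ≤ t → deriv f t ≤ v₀ + a * t := by
    intro t ht
    have hA : Antitone (fun t => deriv f t - a * t) := by
      apply antitone_of_hasDerivAt_nonpos (f' := fun t => deriv (deriv f) t - a * 1)
      · intro x
        exact (hf' x).hasDerivAt.sub ((hasDerivAt_id x).const_mul a)
      · intro x
        have := (abs_le.mp (hacc x)).2
        simp only [Pi.zero_apply]
        linarith
    have := hA ht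
    simp only [hfv0] at this
    linarith
  have h2 : D ≤ v₀ * T + a * T ^ 2 / 2 := by
    have hd : ∀ x, HasDerivAt (fun t => f t - (v₀ * t + a * t ^ 2 / 2))
        (deriv f x - (v₀ * 1 + a * (2 * x) / 2)) x := by
      intro x
      have hp : HasDerivAt (fun t : ℝ => t ^ 2) (2 * x) x := by
        simpa using hasDerivAt_pow 2 x
      exact (hf x).hasDerivAt.sub
        (((hasDerivAt_id x).const_mul v₀).add ((hp.const_mul a).div_const 2))
    have hA : AntitoneOn (fun t => f t - (v₀ * t + a * t ^ 2 / 2)) (Set.Ici 0) := by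
      apply antitoneOn_of_deriv_nonpos (convex_Ici 0)
      · exact fun x _ => (hd x).continuousAt.continuousWithinAt
      · exact fun x _ => (hd x).differentiableAt.differentiableWithinAt
      · intro x hx
        rw [interior_Ici] at hx
        rw [(hd x).deriv]
        have := h1 x (le_of_lt hx)
        linarith
    have := hA (Set.mem_Ici.mpr le_rfl) (Set.mem_Ici.mpr hT) hT
    simp only [h0, hfT] at this
    linarith
  rw [ge_iff_le, hδt, div_le_iff₀ ha]
  have h3 : Real.sqrt (v₀ ^ 2 + 2 * a * D) ≤ v₀ + a * T := by
    apply Real.sqrt_le_iff.mpr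
    refine ⟨by positivity, ?_⟩
    nlinarith [mul_le_mul_of_nonneg_left h2 ha.le]
  linarith
end
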